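/- arXiv:1902.08966 — 2 statements merged into one kernel-verified Lean document; each statement's English description precedes it below -/
import Mathlib

section
/- For every integer n ≥ 1, the component of M_n of y-degree zero is isomorphic to the super-coinvariant ring: the part of the ideal I_n of y-degree zero equals the ideal of the subring Q[x_1,…,x_n, θ_1,…,θ_n] ⊆ R_n generated by the power sums p_{r,0} = Σ_i x_i^r for 0 < r ≤ n and the elements p̃_{r',0} = Σ_i x_i^{r'} θ_i for 0 ≤ r' < n, and hence the y-degree-zero homogeneous component of M_n = R_n / I_n is isomorphic, as a bigraded S_n-module, to Q[x_1,…,x_n, θ_1,…,θ_n] / (p_{r,0} : 0 < r ≤ n; p̃_{r',0} : 0 ≤ r' < n). -/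
open scoped TensorProduct

set_option synthInstance.maxHeartbeats 1000000
set_option maxHeartbeats 1000000

noncomputable section

/-- The commutative polynomial ring `A_n = ℚ[x_1,…,x_n, y_1,…,y_n]`,
with variable `(i, 0)` playing the role of `x_i` and `(i, 1)` that of `y_i`. -/
abbrev An (n : ℕ) : Type := MvPolynomial (Fin n × Fin 2) ℚ

/-- The Grassmann algebra `Λ(θ_1,…,θ_n)` over `ℚ`. -/
abbrev Ln (n : ℕ) : Type := ExteriorAlgebra ℚ (Fin n → ℚ)

/-- The ring `R_n = ℚ[x_1,…,x_n,y_1,…,y_n,θ_1,…,θ_n]`, realized as `A_n ⊗ Λ(θ)`. -/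
abbrev Rn (n : ℕ) : Type := An n ⊗[ℚ] Ln n

/-- The variable `x_i`. -/
def Xv {n : ℕ} (i : Fin n) : An n := MvPolynomial.X (i, 0)

/-- The variable `y_i`. -/
def Yv {n : ℕ} (i : Fin n) : An n := MvPolynomial.X (i, 1)

/-- The Grassmann variable `θ_i` inside `Λ(θ)`. -/
def th {n : ℕ} (i : Fin n) : Ln n := ExteriorAlgebra.ι ℚ (Pi.single i 1)

/-- The Grassmann variable `θ_i` as an element of `R_n`. -/
def thR {n : ℕ} (i : Fin n) : Rn n := (1 : An n) ⊗ₜ[ℚ] th i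

/-- The polarized power sum `p_{r,s} = Σ_i x_i^r y_i^s` in `A_n`. -/
def pA (n r s : ℕ) : An n := ∑ i : Fin n, Xv i ^ r * Yv i ^ s

/-- The polarized power sum `p_{r,s}` as an element of `R_n`. -/
def pR (n r s : ℕ) : Rn n := pA n r s ⊗ₜ[ℚ] 1

/-- The super power sum `p̃_{r,s} = Σ_i x_i^r y_i^s θ_i` in `R_n`. -/
def ptR (n r s : ℕ) : Rn n := ∑ i : Fin n, (Xv i ^ r * Yv i ^ s) ⊗ₜ[ℚ] th i

/-- The set of generators of the ideal `I_n`. -/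
def genSet (n : ℕ) : Set (Rn n) :=
  {z | ∃ r s : ℕ, 0 < r + s ∧ r + s ≤ n ∧ z = pR n r s} ∪
    {z | ∃ r s : ℕ, r + s < n ∧ z = ptR n r s}

/-- The two-sided ideal `I_n` of `R_n`. -/
def In (n : ℕ) : TwoSidedIdeal (Rn n) := TwoSidedIdeal.span (genSet n)

/-- The ideal `I_n` viewed as a `ℚ`-submodule of `R_n`. -/
def Isub (n : ℕ) : Submodule ℚ (Rn n) := Submodule.span ℚ ((In n : Set (Rn n)))

/-- The super-diagonal coinvariant module `M_n = R_n / I_n`. -/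
abbrev Mn (n : ℕ) := Rn n ⧸ Isub n

/-- The action of a permutation `σ` on `A_n`, permuting indices of the `x` and `y`
variables simultaneously: `x_i ↦ x_{σ i}`, `y_i ↦ y_{σ i}`. -/
def permA {n : ℕ} (σ : Equiv.Perm (Fin n)) : An n ≃ₐ[ℚ] An n :=
  MvPolynomial.renameEquiv ℚ (σ.prodCongr (Equiv.refl (Fin 2)))

/-- The linear action of a permutation on `Fin n → ℚ`, sending
`Pi.single i 1 ↦ Pi.single (σ i) 1`. -/
def permV {n : ℕ} (σ : Equiv.Perm (Fin n)) : (Fin n → ℚ) ≃ₗ[ℚ] (Fin n → ℚ) :=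
  LinearEquiv.funCongrLeft ℚ ℚ (σ⁻¹ : Equiv.Perm (Fin n))

/-- The action of a permutation `σ` on the Grassmann algebra, with `θ_i ↦ θ_{σ i}`. -/
def permL {n : ℕ} (σ : Equiv.Perm (Fin n)) : Ln n ≃ₐ[ℚ] Ln n :=
  AlgEquiv.ofAlgHom (ExteriorAlgebra.map (permV σ).toLinearMap)
    (ExteriorAlgebra.map (permV σ).symm.toLinearMap)
    (by rw [ExteriorAlgebra.map_comp_map]
        convert ExteriorAlgebra.map_id using 2
        ext x; simp)
    (by rw [ExteriorAlgebra.map_comp_map]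
        convert ExteriorAlgebra.map_id using 2
        ext x; simp)

/-- The diagonal action of a permutation `σ` on `R_n`, simultaneously permuting the
indices of the three sets of variables: `x_i ↦ x_{σ i}`, `y_i ↦ y_{σ i}`, `θ_i ↦ θ_{σ i}`. -/
def actR {n : ℕ} (σ : Equiv.Perm (Fin n)) : Rn n ≃ₐ[ℚ] Rn n :=
  Algebra.TensorProduct.congr (permA σ) (permL σ)

/-- The weight function recording the `x`-degree and `y`-degree of each variable. -/
def wxy (n : ℕ) : Fin n × Fin 2 → ℕ × ℕ := fun q => if q.2 = 0 then (1, 0) else (0, 1)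

/-- The space of polynomials in `A_n` homogeneous of degree `a` in the `x`-variables
and degree `b` in the `y`-variables. -/
def bidegA (n a b : ℕ) : Submodule ℚ (An n) :=
  MvPolynomial.weightedHomogeneousSubmodule ℚ (wxy n) (a, b)

/-- The space of elements of the Grassmann algebra homogeneous of degree `c` in the
`θ`-variables. -/
def thetaDeg (n c : ℕ) : Submodule ℚ (Ln n) := ⋀[ℚ]^c (Fin n → ℚ)

/-- The tri-homogeneous component `R_n^{(a,b,c)}` of `R_n`, of degree `a` in the
`x`-variables, `b` in the `y`-variables and `c` in the `θ`-variables. -/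
def comp3 (n a b c : ℕ) : Submodule ℚ (Rn n) :=
  LinearMap.range (TensorProduct.map (bidegA n a b).subtype (thetaDeg n c).subtype)

/-- The homogeneous component of `R_n` of degree `c` in the `θ`-variables. -/
def thetaComp (n c : ℕ) : Submodule ℚ (Rn n) :=
  LinearMap.range
    (TensorProduct.map (⊤ : Submodule ℚ (An n)).subtype (thetaDeg n c).subtype)

end

noncomputable section

/-- The ring `ℚ[x_1,…,x_n, θ_1,…,θ_n]`, realized as `ℚ[x_1,…,x_n] ⊗ Λ(θ)`. -/
abbrev Sn (n : ℕ) : Type := MvPolynomial (Fin n) ℚ ⊗[ℚ] Ln n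

/-- The power sum `p_{r,0} = Σ_i x_i^r` as an element of `ℚ[x_1,…,x_n,θ_1,…,θ_n]`. -/
def pS (n r : ℕ) : Sn n := (∑ i : Fin n, MvPolynomial.X i ^ r) ⊗ₜ[ℚ] 1

/-- The super power sum `p̃_{r,0} = Σ_i x_i^r θ_i` in `ℚ[x_1,…,x_n,θ_1,…,θ_n]`. -/
def ptS (n r : ℕ) : Sn n := ∑ i : Fin n, (MvPolynomial.X i ^ r) ⊗ₜ[ℚ] th i

/-- The ideal of `ℚ[x_1,…,x_n,θ_1,…,θ_n]` generated by `p_{r,0}` for `0 < r ≤ n`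
and `p̃_{r',0}` for `0 ≤ r' < n`; the quotient by it is the super-coinvariant ring. -/
def Kn (n : ℕ) : TwoSidedIdeal (Sn n) :=
  TwoSidedIdeal.span
    ({z | ∃ r : ℕ, 0 < r ∧ r ≤ n ∧ z = pS n r} ∪ {z | ∃ r : ℕ, r < n ∧ z = ptS n r})

/-- The ideal `K_n` viewed as a `ℚ`-submodule of `ℚ[x_1,…,x_n,θ_1,…,θ_n]`. -/
def Ksub (n : ℕ) : Submodule ℚ (Sn n) := Submodule.span ℚ ((Kn n : Set (Sn n)))

/-- The inclusion of the subring `ℚ[x_1,…,x_n,θ_1,…,θ_n]` into `R_n`. -/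
def embS (n : ℕ) : Sn n →ₐ[ℚ] Rn n :=
  Algebra.TensorProduct.map
    (MvPolynomial.rename (fun i : Fin n => ((i, 0) : Fin n × Fin 2))) (AlgHom.id ℚ (Ln n))

/-- The action of `σ ∈ S_n` on `ℚ[x_1,…,x_n,θ_1,…,θ_n]`, with `x_i ↦ x_{σ i}` and
`θ_i ↦ θ_{σ i}`. -/
def actS {n : ℕ} (σ : Equiv.Perm (Fin n)) : Sn n ≃ₐ[ℚ] Sn n :=
  Algebra.TensorProduct.congr (MvPolynomial.renameEquiv ℚ σ) (permL σ)

/-- The weight function recording the `y`-degree of each variable of `A_n`. -/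
def wy (n : ℕ) : Fin n × Fin 2 → ℕ := fun q => if q.2 = 0 then 0 else 1

/-- The `ℚ`-submodule of `A_n` of polynomials of degree zero in the `y`-variables. -/
def yZeroA (n : ℕ) : Submodule ℚ (An n) :=
  MvPolynomial.weightedHomogeneousSubmodule ℚ (wy n) 0

/-- The homogeneous component of `R_n` of degree zero in the `y`-variables. -/
def yZeroR (n : ℕ) : Submodule ℚ (Rn n) :=
  LinearMap.range
    (TensorProduct.map (yZeroA n).subtype (⊤ : Submodule ℚ (Ln n)).subtype)

/-- The bi-homogeneous component of `ℚ[x_1,…,x_n,θ_1,…,θ_n]` of degree `a` in the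
`x`-variables and degree `c` in the `θ`-variables. -/
def bidegS (n a c : ℕ) : Submodule ℚ (Sn n) :=
  LinearMap.range
    (TensorProduct.map (MvPolynomial.homogeneousSubmodule (Fin n) ℚ a).subtype
      (thetaDeg n c).subtype)

/-- The algebra map `A_n → ℚ[x]` setting all `y_i` to zero. -/
def auxRA (n : ℕ) : An n →ₐ[ℚ] MvPolynomial (Fin n) ℚ :=
  MvPolynomial.aeval (fun q : Fin n × Fin 2 => if q.2 = 0 then MvPolynomial.X q.1 else 0)

/-- The algebra map `R_n → ℚ[x,θ]` setting all `y_i` to zero. -/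
def auxR (n : ℕ) : Rn n →ₐ[ℚ] Sn n :=
  Algebra.TensorProduct.map (auxRA n) (AlgHom.id ℚ (Ln n))

theorem auxRA_X {n : ℕ} (i : Fin n) : auxRA n (Xv i) = MvPolynomial.X i := by
  simp [auxRA, Xv]

theorem auxRA_Y {n : ℕ} (i : Fin n) : auxRA n (Yv i) = 0 := by
  simp [auxRA, Yv]

theorem auxR_tmul {n : ℕ} (a : An n) (b : Ln n) :
    auxR n (a ⊗ₜ[ℚ] b) = (auxRA n a) ⊗ₜ[ℚ] b := by
  simp [auxR]

theorem embS_tmul {n : ℕ} (a : MvPolynomial (Fin n) ℚ) (b : Ln n) :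
    embS n (a ⊗ₜ[ℚ] b) =
      (MvPolynomial.rename (fun i : Fin n => ((i, 0) : Fin n × Fin 2)) a) ⊗ₜ[ℚ] b := by
  simp [embS]

theorem auxRA_rename {n : ℕ} (a : MvPolynomial (Fin n) ℚ) :
    auxRA n (MvPolynomial.rename (fun i : Fin n => ((i, 0) : Fin n × Fin 2)) a) = a := by
  simp only [auxRA, MvPolynomial.aeval_rename]
  have : ((fun q : Fin n × Fin 2 => if q.2 = 0 then (MvPolynomial.X q.1 : MvPolynomial (Fin n) ℚ)
      else 0) ∘ fun i : Fin n => ((i, 0) : Fin n × Fin 2)) = MvPolynomial.X := by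
    funext i; simp
  rw [this]; simp

theorem auxR_embS {n : ℕ} (g : Sn n) : auxR n (embS n g) = g := by
  induction g using TensorProduct.induction_on with
  | zero => simp
  | tmul a b => rw [embS_tmul, auxR_tmul, auxRA_rename]
  | add x y hx hy => rw [map_add, map_add, hx, hy]

theorem auxR_pR (n r s : ℕ) : auxR n (pR n r s) = if s = 0 then pS n r else 0 := by
  rw [pR, auxR_tmul, pA, map_sum]
  simp only [map_mul, map_pow, auxRA_X, auxRA_Y]
  split_ifs with h
  · subst h; simp [pS]
  · simp [zero_pow h]

theorem auxR_ptR (n r s : ℕ) : auxR n (ptR n r s) = if s = 0 then ptS n r else 0 := by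
  rw [ptR, map_sum]
  simp only [auxR_tmul, map_mul, map_pow, auxRA_X, auxRA_Y]
  split_ifs with h
  · subst h; simp [ptS]
  · simp [zero_pow h]

theorem embS_pS (n r : ℕ) : embS n (pS n r) = pR n r 0 := by
  rw [pS, embS_tmul, pR, pA]
  simp [Xv]

theorem embS_ptS (n r : ℕ) : embS n (ptS n r) = ptR n r 0 := by
  rw [ptS, ptR, map_sum]
  simp [embS_tmul, Xv]

theorem auxR_mem {n : ℕ} {z : Rn n} (hz : z ∈ In n) : auxR n z ∈ Kn n := by
  have h : In n ≤ (Kn n).comap (auxR n) := by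
    rw [In, TwoSidedIdeal.span_le]
    rintro z (⟨r, s, h0, h1, rfl⟩ | ⟨r, s, h1, rfl⟩)
    · rw [SetLike.mem_coe, TwoSidedIdeal.mem_comap, auxR_pR]
      split_ifs with h
      · exact TwoSidedIdeal.subset_span (Or.inl ⟨r, by omega, by omega, rfl⟩)
      · exact TwoSidedIdeal.zero_mem _
    · rw [SetLike.mem_coe, TwoSidedIdeal.mem_comap, auxR_ptR]
      split_ifs with h
      · exact TwoSidedIdeal.subset_span (Or.inr ⟨r, by omega, rfl⟩)
      · exact TwoSidedIdeal.zero_mem _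
  exact (TwoSidedIdeal.mem_comap _).1 (h hz)

theorem embS_mem {n : ℕ} {g : Sn n} (hg : g ∈ Kn n) : embS n g ∈ In n := by
  have h : Kn n ≤ (In n).comap (embS n) := by
    rw [Kn, TwoSidedIdeal.span_le]
    rintro z (⟨r, h0, h1, rfl⟩ | ⟨r, h1, rfl⟩)
    · rw [SetLike.mem_coe, TwoSidedIdeal.mem_comap, embS_pS]
      exact TwoSidedIdeal.subset_span (Or.inl ⟨r, 0, by omega, by omega, rfl⟩)
    · rw [SetLike.mem_coe, TwoSidedIdeal.mem_comap, embS_ptS]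
      exact TwoSidedIdeal.subset_span (Or.inr ⟨r, 0, by omega, rfl⟩)
  exact (TwoSidedIdeal.mem_comap _).1 (h hg)

theorem Isub_le (n : ℕ) : Isub n ≤ (Ksub n).comap (auxR n).toLinearMap := by
  rw [Isub, Submodule.span_le]
  intro z hz
  exact Submodule.subset_span (auxR_mem hz)

theorem Ksub_le (n : ℕ) : Ksub n ≤ (Isub n).comap (embS n).toLinearMap := by
  rw [Ksub, Submodule.span_le]
  intro z hz
  exact Submodule.subset_span (embS_mem hz)

theorem rename_auxRA {n : ℕ} {a : An n} (ha : a ∈ yZeroA n) :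
    MvPolynomial.rename (fun i : Fin n => ((i, 0) : Fin n × Fin 2)) (auxRA n a) = a := by
  have key : ∀ d ∈ a.support,
      MvPolynomial.rename (fun i : Fin n => ((i, 0) : Fin n × Fin 2))
        (auxRA n (MvPolynomial.monomial d (a.coeff d))) = MvPolynomial.monomial d (a.coeff d) := by
    intro d hd
    have hw : Finsupp.weight (wy n) d = 0 := ha (MvPolynomial.mem_support_iff.1 hd)
    have hd0 : ∀ q ∈ d.support, q.2 = 0 := by
      intro q hq
      by_contra h
      rw [Finsupp.weight_apply, Finsupp.sum, Finset.sum_eq_zero_iff] at hw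
      have := hw q hq
      simp [wy, h] at this
      simp [this] at hq
    rw [MvPolynomial.monomial_eq, map_mul, map_mul, Finsupp.prod, map_prod, map_prod]
    congr 1
    · simp [auxRA]
    · refine Finset.prod_congr rfl fun q hq => ?_
      obtain ⟨i, j⟩ := q
      have := hd0 _ hq
      simp only at this
      subst this
      simp [auxRA]
  conv_lhs => rw [a.as_sum]
  rw [map_sum, map_sum, Finset.sum_congr rfl key, ← a.as_sum]

theorem embS_auxR {n : ℕ} {z : Rn n} (hz : z ∈ yZeroR n) : embS n (auxR n z) = z := by
  obtain ⟨t, rfl⟩ := hz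
  induction t using TensorProduct.induction_on with
  | zero => simp
  | tmul a b =>
    rw [TensorProduct.map_tmul, auxR_tmul, embS_tmul]
    rw [Submodule.subtype_apply, rename_auxRA a.2]
  | add x y hx hy => rw [map_add, map_add, map_add, hx, hy]

theorem auxRA_homog {n a b : ℕ} {f : An n} (hf : f ∈ bidegA n a b) :
    auxRA n f ∈ MvPolynomial.homogeneousSubmodule (Fin n) ℚ a := by
  rw [f.as_sum, map_sum]
  refine Submodule.sum_mem _ fun d hd => ?_
  have hw : Finsupp.weight (wxy n) d = (a, b) := hf (MvPolynomial.mem_support_iff.1 hd)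
  have hw1 : ∑ q ∈ d.support, (if q.2 = 0 then 1 else 0) * d q = a := by
    have := congrArg Prod.fst hw
    rw [Finsupp.weight_apply, Finsupp.sum, Prod.fst_sum] at this
    refine Eq.trans ?_ this
    refine Finset.sum_congr rfl fun q _ => ?_
    by_cases h : q.2 = 0 <;> simp [wxy, h]
  rw [MvPolynomial.mem_homogeneousSubmodule, auxRA, MvPolynomial.aeval_monomial]
  rw [← zero_add a, ← hw1]
  refine (MvPolynomial.isHomogeneous_C _ _).mul (MvPolynomial.IsHomogeneous.prod _ _ _ ?_)
  intro q _
  refine MvPolynomial.IsHomogeneous.pow ?_ _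
  split_ifs
  · exact MvPolynomial.isHomogeneous_X _ _
  · exact MvPolynomial.isHomogeneous_zero _ _ _

theorem auxR_bideg {n a b c : ℕ} {z : Rn n} (hz : z ∈ comp3 n a b c) :
    auxR n z ∈ bidegS n a c := by
  obtain ⟨t, rfl⟩ := hz
  induction t using TensorProduct.induction_on with
  | zero => simp
  | tmul f g =>
    rw [TensorProduct.map_tmul, auxR_tmul]
    exact ⟨⟨_, auxRA_homog f.2⟩ ⊗ₜ[ℚ] g, by simp⟩
  | add x y hx hy => rw [map_add, map_add]; exact Submodule.add_mem _ hx hy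

theorem embS_mem_yZero {n : ℕ} (g : Sn n) : embS n g ∈ yZeroR n := by
  induction g using TensorProduct.induction_on with
  | zero => simp
  | tmul a b =>
    rw [embS_tmul]
    have h : MvPolynomial.rename (fun i : Fin n => ((i, 0) : Fin n × Fin 2)) a ∈ yZeroA n := by
      induction a using MvPolynomial.induction_on with
      | C r => rw [MvPolynomial.rename_C]; exact MvPolynomial.isWeightedHomogeneous_C _ _
      | add p q hp hq => rw [map_add]; exact Submodule.add_mem _ hp hq
      | mul_X p i hp =>
        rw [map_mul, MvPolynomial.rename_X]
        have := MvPolynomial.IsWeightedHomogeneous.mul hp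
          (MvPolynomial.isWeightedHomogeneous_X ℚ (wy n) (i, 0))
        have h0 : wy n (i, 0) = 0 := by simp [wy]
        rw [h0, add_zero] at this
        exact this
    exact ⟨⟨_, h⟩ ⊗ₜ[ℚ] ⟨b, trivial⟩, by simp⟩
  | add x y hx hy => rw [map_add]; exact Submodule.add_mem _ hx hy

theorem actR_embS {n : ℕ} (σ : Equiv.Perm (Fin n)) (g : Sn n) :
    actR σ (embS n g) = embS n (actS σ g) := by
  induction g using TensorProduct.induction_on with
  | zero => simp
  | tmul a b =>
    have h1 : actS σ (a ⊗ₜ[ℚ] b) = (MvPolynomial.rename σ a) ⊗ₜ[ℚ] (permL σ b) := rfl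
    have h2 : ∀ f : An n, actR σ (f ⊗ₜ[ℚ] b) =
      (MvPolynomial.rename (σ.prodCongr (Equiv.refl (Fin 2))) f) ⊗ₜ[ℚ] (permL σ b) := fun _ => rfl
    rw [h1, embS_tmul, embS_tmul, h2, MvPolynomial.rename_rename, MvPolynomial.rename_rename]
    rfl
  | add x y hx hy => rw [map_add, map_add, map_add, map_add, hx, hy]

/-- For every `n ≥ 1`, the component of `M_n` of `y`-degree zero is isomorphic to the
super-coinvariant ring: the part of the ideal `I_n` of `y`-degree zero equals the
ideal of `ℚ[x_1,…,x_n,θ_1,…,θ_n] ⊆ R_n` generated by the power sums `p_{r,0}` for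
`0 < r ≤ n` and the `p̃_{r',0}` for `0 ≤ r' < n`, and hence the `y`-degree-zero
homogeneous component of `M_n = R_n / I_n` is isomorphic, as a bigraded `S_n`-module,
to `ℚ[x_1,…,x_n,θ_1,…,θ_n] / (p_{r,0} : 0 < r ≤ n; p̃_{r',0} : 0 ≤ r' < n)`.  The
isomorphism `e` is characterized by `e (g mod I_n) = g mod K_n`; it respects the
bigrading and intertwines the `S_n`-actions. -/
theorem y_degree_zero_part_is_super_coinvariants (n : ℕ) (hn : 1 ≤ n) :
    (∀ g : Sn n, embS n g ∈ In n ↔ g ∈ Kn n) ∧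
    ∃ e : ↥(Submodule.map (Isub n).mkQ (yZeroR n)) ≃ₗ[ℚ] (Sn n ⧸ Ksub n),
      (∀ (x : ↥(Submodule.map (Isub n).mkQ (yZeroR n))) (g : Sn n),
        (x : Mn n) = (Isub n).mkQ (embS n g) → e x = (Ksub n).mkQ g) ∧
      (∀ (a c : ℕ) (x : ↥(Submodule.map (Isub n).mkQ (yZeroR n))),
        (x : Mn n) ∈ Submodule.map (Isub n).mkQ (comp3 n a 0 c) →
          e x ∈ Submodule.map (Ksub n).mkQ (bidegS n a c)) ∧
      (∀ (σ : Equiv.Perm (Fin n)) (y : ↥(Submodule.map (Isub n).mkQ (yZeroR n)))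
        (g : Sn n),
        (y : Mn n) = (Isub n).mkQ ((actR σ) (embS n g)) →
          e y = (Ksub n).mkQ (actS σ g)) := by
  refine ⟨fun g => ⟨fun h => ?_, embS_mem⟩, ?_⟩
  · have := auxR_mem h
    rwa [auxR_embS] at this
  let φ : ↥(Submodule.map (Isub n).mkQ (yZeroR n)) →ₗ[ℚ] (Sn n ⧸ Ksub n) :=
    ((Isub n).mapQ (Ksub n) (auxR n).toLinearMap (Isub_le n)).comp (Submodule.subtype _)
  have hφ : ∀ (x : ↥(Submodule.map (Isub n).mkQ (yZeroR n))) (z : Rn n),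
      (x : Mn n) = (Isub n).mkQ z → φ x = (Ksub n).mkQ (auxR n z) := by
    intro x z h
    change (Isub n).mapQ (Ksub n) (auxR n).toLinearMap (Isub_le n) (x : Mn n) = _
    rw [h]
    rfl
  have hbij : Function.Bijective φ := by
    constructor
    · rw [injective_iff_map_eq_zero]
      rintro ⟨x, z, hz, rfl⟩ h0
      rw [hφ _ z rfl, Submodule.mkQ_apply, Submodule.Quotient.mk_eq_zero] at h0
      have h1 := Ksub_le n h0
      rw [Submodule.mem_comap, AlgHom.toLinearMap_apply, embS_auxR hz] at h1
      apply Subtype.ext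
      exact (Submodule.Quotient.mk_eq_zero _).2 h1
    · intro y
      obtain ⟨g, rfl⟩ := Submodule.mkQ_surjective _ y
      refine ⟨⟨_, embS n g, embS_mem_yZero g, rfl⟩, ?_⟩
      rw [hφ _ (embS n g) rfl, auxR_embS]
  refine ⟨LinearEquiv.ofBijective φ hbij, ?_, ?_, ?_⟩
  · intro x g h
    rw [LinearEquiv.ofBijective_apply, hφ _ _ h, auxR_embS]
  · rintro a c x ⟨z, hz, h⟩
    rw [LinearEquiv.ofBijective_apply, hφ _ _ h.symm]
    exact ⟨_, auxR_bideg hz, rfl⟩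
  · intro σ y g h
    rw [LinearEquiv.ofBijective_apply, hφ _ _ h, actR_embS, auxR_embS]

end
end

section
/- For every integer n ≥ 1, the quotient M_n = R_n / I_n is a finite-dimensional vector space over Q; in particular each tri-homogeneous component M_n^{(a,b,c)} is finite-dimensional, and all but finitely many of these components are zero. -/
open scoped TensorProduct

set_option synthInstance.maxHeartbeats 1000000
set_option maxHeartbeats 1000000

noncomputable section

lemma pow_eq_zero_of_psum {B : Type*} [CommRing B] [Algebra ℚ B] (n : ℕ) (g : Fin n → B)
    (h : ∀ k, 0 < k → k ≤ n → ∑ i, g i ^ k = 0) (i : Fin n) : g i ^ n = 0 := by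
  have he : ∀ k, 0 < k → k ≤ n → MvPolynomial.aeval g (MvPolynomial.esymm (Fin n) ℚ k) = 0 := by
    intro k hk hkn
    have h1 := congrArg (MvPolynomial.aeval g) (MvPolynomial.mul_esymm_eq_sum (Fin n) ℚ k)
    rw [map_mul, map_mul, map_sum, Finset.sum_eq_zero, mul_zero, map_natCast] at h1
    · have hu : IsUnit ((k : ℕ) : B) := by
        have : IsUnit ((k : ℕ) : ℚ) := by
          rw [isUnit_iff_ne_zero]; exact_mod_cast hk.ne'
        simpa using this.map (algebraMap ℚ B)
      exact hu.mul_right_eq_zero.mp h1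
    · intro a ha
      rw [Finset.mem_filter, Finset.HasAntidiagonal.mem_antidiagonal] at ha
      rw [map_mul]
      have : MvPolynomial.aeval g (MvPolynomial.psum (Fin n) ℚ a.2) = 0 := by
        simp only [MvPolynomial.psum, map_sum, map_pow, MvPolynomial.aeval_X]
        exact h _ (by omega) (by omega)
      rw [this, mul_zero]
  have hp := congrArg (Polynomial.eval (g i))
    (Multiset.prod_X_sub_X_eq_sum_esymm ((Finset.univ : Finset (Fin n)).val.map g))
  rw [Polynomial.eval_finsetSum, Finset.sum_eq_single 0] at hp
  · rw [Multiset.map_map, Polynomial.eval_multiset_prod, Multiset.map_map] at hp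
    have h0 : (Multiset.map (Polynomial.eval (g i) ∘ (fun t => Polynomial.X - Polynomial.C t) ∘ g)
        (Finset.univ : Finset (Fin n)).val).prod = 0 := by
      change ∏ j : Fin n, Polynomial.eval (g i) (Polynomial.X - Polynomial.C (g j)) = 0
      apply Finset.prod_eq_zero (Finset.mem_univ i)
      simp
    rw [h0] at hp
    simpa [Multiset.esymm] using hp.symm
  · intro j hj hj0
    have hjn : j ≤ n := by simpa [Nat.lt_succ_iff] using hj
    rw [← MvPolynomial.aeval_esymm_eq_multiset_esymm (Fin n) ℚ, he j (by omega) hjn]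
    simp
  · simp

/-- Ideal of `A_n` of elements landing in `I_n`. -/
def JA (n : ℕ) : Ideal (An n) where
  carrier := {a | a ⊗ₜ[ℚ] (1 : Ln n) ∈ In n}
  zero_mem' := by
    simp only [Set.mem_ofPred_eq, TensorProduct.zero_tmul]
    exact (In n).zero_mem
  add_mem' := by
    intro a b ha hb
    simp only [Set.mem_ofPred_eq, TensorProduct.add_tmul] at *
    exact (In n).add_mem ha hb
  smul_mem' := by
    intro c x hx
    simp only [Set.mem_ofPred_eq, smul_eq_mul] at *
    have := (In n).mul_mem_left (c ⊗ₜ[ℚ] (1 : Ln n)) _ hx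
    rwa [Algebra.TensorProduct.tmul_mul_tmul, one_mul] at this

lemma tmul_mem_Isub {n : ℕ} {a : An n} (ha : a ∈ JA n) (l : Ln n) :
    a ⊗ₜ[ℚ] l ∈ Isub n := by
  apply Submodule.subset_span
  have ha' : a ⊗ₜ[ℚ] (1 : Ln n) ∈ In n := ha
  have := (In n).mul_mem_right _ ((1 : An n) ⊗ₜ[ℚ] l) ha'
  rwa [Algebra.TensorProduct.tmul_mul_tmul, one_mul, mul_one] at this

lemma pA_mem {n r s : ℕ} (h : 0 < r + s) (h' : r + s ≤ n) : pA n r s ∈ JA n :=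
  TwoSidedIdeal.subset_span (Or.inl ⟨r, s, h, h', rfl⟩)

lemma X_pow_mem {n : ℕ} (q : Fin n × Fin 2) :
    (MvPolynomial.X q : An n) ^ n ∈ JA n := by
  obtain ⟨i, e⟩ := q
  rw [← Ideal.Quotient.eq_zero_iff_mem, map_pow]
  refine pow_eq_zero_of_psum n
    (fun j => Ideal.Quotient.mk (JA n) (MvPolynomial.X (j, e))) ?_ i
  intro k hk hkn
  simp only [← map_pow, ← map_sum]
  rw [Ideal.Quotient.eq_zero_iff_mem]
  fin_cases e
  · simpa [pA, Xv, Yv] using pA_mem (n := n) (r := k) (s := 0) (by omega) (by omega)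
  · simpa [pA, Xv, Yv] using pA_mem (n := n) (r := 0) (s := k) (by omega) (by omega)

lemma finite_AJ (n : ℕ) (hn : 1 ≤ n) : Module.Finite ℚ (An n ⧸ JA n) := by
  have hint : Algebra.IsIntegral ℚ (An n ⧸ JA n) := by
    constructor
    intro x
    obtain ⟨a, rfl⟩ := Ideal.Quotient.mk_surjective x
    induction a using MvPolynomial.induction_on with
    | C r => exact isIntegral_algebraMap (x := r)
    | add p q hp hq => rw [map_add]; exact hp.add hq
    | mul_X p i hp =>
      rw [map_mul]
      refine hp.mul (IsIntegral.of_pow (n := n) hn ?_)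
      rw [← map_pow, Ideal.Quotient.eq_zero_iff_mem.mpr (X_pow_mem i)]
      exact isIntegral_zero
  have : Algebra.FiniteType ℚ (An n ⧸ JA n) :=
    Algebra.FiniteType.of_surjective (Ideal.Quotient.mkₐ ℚ (JA n)) Ideal.Quotient.mk_surjective
  exact Algebra.IsIntegral.finite

lemma finite_Ln (n : ℕ) : Module.Finite ℚ (Ln n) :=
  Module.Finite.of_basis (Module.Basis.ExteriorAlgebra (Pi.basisFun ℚ (Fin n)))

lemma finite_Mn (n : ℕ) (hn : 1 ≤ n) : Module.Finite ℚ (Mn n) := by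
  have := finite_AJ n hn
  have := finite_Ln n
  let f : An n →ₗ[ℚ] Ln n →ₗ[ℚ] Mn n := TensorProduct.curry (Isub n).mkQ
  have hf : (JA n).restrictScalars ℚ ≤ LinearMap.ker f := by
    intro a ha
    rw [LinearMap.mem_ker]
    refine LinearMap.ext fun l => ?_
    change (Isub n).mkQ (a ⊗ₜ l) = 0
    rw [Submodule.mkQ_apply, Submodule.Quotient.mk_eq_zero]
    exact tmul_mem_Isub ha l
  let g : (An n ⧸ (JA n).restrictScalars ℚ) ⊗[ℚ] Ln n →ₗ[ℚ] Mn n :=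
    TensorProduct.lift (Submodule.liftQ _ f hf)
  have : Module.Finite ℚ (An n ⧸ (JA n).restrictScalars ℚ) := finite_AJ n hn
  refine Module.Finite.of_surjective g ?_
  rw [← LinearMap.range_eq_top, eq_top_iff]
  intro x _
  obtain ⟨y, rfl⟩ := Submodule.mkQ_surjective _ x
  induction y using TensorProduct.induction_on with
  | zero => rw [map_zero]; exact Submodule.zero_mem _
  | tmul a l => exact ⟨(Submodule.Quotient.mk a) ⊗ₜ l, rfl⟩
  | add p q hp hq => rw [map_add]; exact Submodule.add_mem _ (hp trivial) (hq trivial)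

lemma weight_fst {n : ℕ} (d : Fin n × Fin 2 →₀ ℕ) :
    (Finsupp.weight (wxy n) d) = (∑ i, d (i, 0), ∑ i, d (i, 1)) := by
  rw [Finsupp.weight_apply, Finsupp.sum_fintype _ _ (by simp), Fintype.sum_prod_type]
  ext <;> simp [wxy, Prod.fst_sum, Prod.snd_sum]

lemma monomial_mem {n : ℕ} (d : Fin n × Fin 2 →₀ ℕ) (q) (h : n ≤ d q) (c : ℚ) :
    MvPolynomial.monomial d c ∈ JA n := by
  refine Ideal.mem_of_dvd _ ?_ (X_pow_mem q)
  rw [MvPolynomial.X_pow_eq_monomial, MvPolynomial.monomial_dvd_monomial]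
  exact ⟨Or.inr (by rw [Finsupp.single_le_iff]; exact h), one_dvd _⟩

lemma bideg_le {n a b : ℕ} (h : n * n < a ∨ n * n < b) : bidegA n a b ≤
    (JA n).restrictScalars ℚ := by
  intro p hp
  have hp' : MvPolynomial.IsWeightedHomogeneous (wxy n) p (a, b) := hp
  change p ∈ JA n
  rw [p.as_sum]
  refine Ideal.sum_mem _ fun d hd => ?_
  have hw := hp' (MvPolynomial.mem_support_iff.mp hd)
  rw [weight_fst, Prod.mk.injEq] at hw
  obtain ⟨hw1, hw2⟩ := hw
  suffices ∃ q, n ≤ d q by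
    obtain ⟨q, hq⟩ := this
    exact monomial_mem d q hq _
  by_contra! hc
  have key : ∀ e : Fin 2, ∑ i : Fin n, d (i, e) ≤ n * n := fun e => by
    calc _ ≤ ∑ i : Fin n, n := Finset.sum_le_sum fun i _ => (hc (i, e)).le
      _ = n * n := by simp
  have := key 0
  have := key 1
  omega

lemma thetaDeg_bot {n c : ℕ} (h : n < c) : thetaDeg n c = ⊥ := by
  have := exteriorPower.finrank_eq ℚ (M := Fin n → ℚ) c
  rw [Module.finrank_fin_fun, Nat.choose_eq_zero_of_lt h] at this
  change (⋀[ℚ]^c (Fin n → ℚ)) = ⊥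
  exact Submodule.finrank_eq_zero.mp this

/-- For every `n ≥ 1`, the quotient `M_n = R_n / I_n` is a finite-dimensional vector
space over `ℚ`; in particular each tri-homogeneous component `M_n^{(a,b,c)}` is
finite-dimensional, and all but finitely many of these components are zero. -/
theorem M_n_finite_dimensional (n : ℕ) (hn : 1 ≤ n) :
    FiniteDimensional ℚ (Mn n) ∧
    (∀ a b c : ℕ,
      FiniteDimensional ℚ ↥(Submodule.map (Isub n).mkQ (comp3 n a b c))) ∧
    {t : ℕ × ℕ × ℕ |
      Submodule.map (Isub n).mkQ (comp3 n t.1 t.2.1 t.2.2) ≠ ⊥}.Finite := by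
  have hM := finite_Mn n hn
  refine ⟨hM, fun a b c => inferInstance, ?_⟩
  refine ((Set.finite_Iic (n * n)).prod ((Set.finite_Iic (n * n)).prod
    (Set.finite_Iic n))).subset ?_
  rintro ⟨a, b, c⟩ h
  simp only [Set.mem_prod, Set.mem_Iic]
  by_contra hc
  apply h
  rw [eq_bot_iff, Submodule.map_le_iff_le_comap]
  rintro _ ⟨z, rfl⟩
  rw [Submodule.mem_comap, Submodule.mem_bot, Submodule.mkQ_apply,
    Submodule.Quotient.mk_eq_zero]
  induction z using TensorProduct.induction_on with
  | zero => rw [map_zero]; exact Submodule.zero_mem _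
  | add p q hp hq => rw [map_add]; exact Submodule.add_mem _ hp hq
  | tmul p l =>
    rw [TensorProduct.map_tmul]
    by_cases hn' : n < c
    · have hl : (l : Ln n) = 0 := by
        have h2 := (thetaDeg_bot hn').le l.2
        exact (Submodule.mem_bot ℚ).mp h2
      rw [Submodule.subtype_apply, Submodule.subtype_apply, hl, TensorProduct.tmul_zero]
      exact Submodule.zero_mem _
    · exact tmul_mem_Isub (bideg_le (by dsimp only; omega) p.2) _

end
end
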